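/- (Representation Formula) Let Ω ⊆ ℝ^{p+q+1} be a p-symmetric slice domain and f ∈ 𝒢𝒮ℳ(Ω). Then for every ω, η ∈ 𝕊 and every 𝐱_p + rω ∈ Ω one has f(𝐱_p + rω) = ½( f(𝐱_p + rη) + f(𝐱_p − rη) ) + ½ ωη ( f(𝐱_p − rη) − f(𝐱_p + rη) ). Moreover the functions F₁(𝐱_p, r) = ½( f(𝐱_p + rη) + f(𝐱_p − rη) ) and F₂(𝐱_p, r) = ½ η( f(𝐱_p − rη) − f(𝐱_p + rη) ) do not depend on the choice of η ∈ 𝕊. -/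

import Mathlib

/-!
Common framework for generalized partial-slice monogenic functions
(Xu–Sabadini, "On the Fueter-Sce theorem for generalized partial-slice
monogenic functions").

The real Clifford algebra `ℝ_{p+q}` is formalized as the Mathlib Clifford
algebra of the negative-definite quadratic form on `ℝ^{p+q}`; since Mathlib
provides no canonical norm on it, all analytic statements are phrased for an
arbitrary normed real algebra `A` together with an `ℝ`-algebra isomorphism
`ξ : A ≃ₐ[ℝ] Cl (p+q)`.  A point of `ℝ^{p+q+1}` is a pair
`(𝐱_p, 𝐱_q) : (Fin (p+1) → ℝ) × EuclideanSpace ℝ (Fin q)`, and a point of a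
slice `ℝ^{p+2}` is a pair `(𝐱_p, r)`.
-/

noncomputable section

open Filter Topology MeasureTheory Metric
open scoped Nat RealInnerProductSpace

namespace GPS

/-- The negative definite quadratic form `-(x₁² + ⋯ + xₙ²)` on `ℝⁿ`. -/
def Qe (n : ℕ) : QuadraticForm ℝ (Fin n → ℝ) :=
  QuadraticMap.weightedSumSquares ℝ (fun _ : Fin n => (-1 : ℝ))

/-- The real Clifford algebra `ℝ_n`. -/
abbrev Cl (n : ℕ) : Type := CliffordAlgebra (Qe n)

/-- The generators `e_1, …, e_n` of `ℝ_n` (indexed by `Fin n`). -/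
def e (n : ℕ) (i : Fin n) : Cl n := CliffordAlgebra.ι (Qe n) (Pi.single i 1)

variable (p q : ℕ)

/-- `ℝ^{p+1}`, the "slice-axis" space. -/
abbrev Vp : Type := Fin (p + 1) → ℝ

/-- `ℝ^q`. -/
abbrev Vq : Type := EuclideanSpace ℝ (Fin q)

/-- `ℝ^{p+q+1} = ℝ^{p+1} ⊕ ℝ^q`. -/
abbrev V : Type := Vp p × Vq q

/-- `ℝ^{p+2}`, the parameter space `(𝐱_p, r)` of a slice. -/
abbrev Sl : Type := Vp p × ℝ

/-- The sphere `𝕊` of unit 1-vectors, described by their coordinate vectors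
`(x_{p+1}, …, x_{p+q}) ∈ ℝ^q` with `∑ x_i² = 1`. -/
def S : Set (Vq q) := {v | ∑ j, v j ^ 2 = 1}

/-- The point `𝐱_p + r ω` of `ℝ^{p+q+1}`. -/
def spt (v : Vq q) (z : Sl p) : V p q := (z.1, z.2 • v)

/-- The (parameterized) slice `Ω_ω` of a set `Ω ⊆ ℝ^{p+q+1}`. -/
def sliceSet (Ω : Set (V p q)) (v : Vq q) : Set (Sl p) := {z | spt p q v z ∈ Ω}

/-- `Ω₀* = {𝐱_p + 𝐱_q : 𝐱_p ∈ Ω₀, 𝐱_q ∈ ℝ^q}`. -/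
def star0 (Ω₀ : Set (Vp p)) : Set (V p q) := {z | z.1 ∈ Ω₀}

/-- The p-symmetric completion `Ω_D` of a set `D ⊆ ℝ^{p+2}`. -/
def completion (D : Set (Sl p)) : Set (V p q) :=
  {x | ∃ z ∈ D, ∃ v ∈ S q, x = spt p q v z}

/-- `D` is invariant under the reflection of the `(p+2)`-th variable. -/
def ReflInv (D : Set (Sl p)) : Prop := ∀ z ∈ D, ((z.1, -z.2) : Sl p) ∈ D

/-- A domain: a nonempty open connected set. -/
def IsDomain {E : Type*} [TopologicalSpace E] (s : Set E) : Prop :=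
  IsOpen s ∧ IsConnected s

/-- A slice domain. -/
def IsSliceDomain (Ω : Set (V p q)) : Prop :=
  IsDomain Ω ∧ (∃ x : Vp p, ((x, 0) : V p q) ∈ Ω) ∧
    ∀ v ∈ S q, IsDomain (sliceSet p q Ω v)

/-- Partial symmetry with respect to `ℝ^{p+1}`. -/
def IsPSymmetric (Ω : Set (V p q)) : Prop :=
  ∀ (x : Vp p) (r : ℝ), ∀ v ∈ S q, ∀ w ∈ S q,
    ((x, r • v) : V p q) ∈ Ω → ((x, r • w) : V p q) ∈ Ω

/-- A `d`-dimensional smooth submanifold of a real normed space. -/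
def IsSmoothSubmanifoldDim {E : Type*} [NormedAddCommGroup E] [NormedSpace ℝ E]
    (d : ℕ) (M : Set E) : Prop :=
  ∀ x ∈ M, ∃ U : Set E, IsOpen U ∧ x ∈ U ∧
    ∃ (ψ : (Fin d → ℝ) → E) (W : Set (Fin d → ℝ)), IsOpen W ∧
      ContDiffOn ℝ (⊤ : ℕ∞) ψ W ∧ Set.InjOn ψ W ∧
      (∀ y ∈ W, Function.Injective (fderivWithin ℝ ψ W y)) ∧
      M ∩ U = ψ '' W

variable {A : Type*} [NormedRing A] [NormedAlgebra ℝ A] (ξ : A ≃ₐ[ℝ] Cl (p + q))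

/-- The generators `e_1, …, e_{p+q}` inside `A`. -/
def gen (i : Fin (p + q)) : A := ξ.symm (e (p + q) i)

/-- The generators `e_{p+1}, …, e_{p+q}` (the "q-part"). -/
def eQ (j : Fin q) : A := gen p q ξ ⟨p + (j : ℕ), by have := j.isLt; omega⟩

/-- The generators `e_1, …, e_p` (the "p-part", without `e_0 = 1`). -/
def eP (i : Fin p) : A := gen p q ξ ⟨(i : ℕ), by have := i.isLt; omega⟩

/-- `e_0 = 1, e_1, …, e_p`: the paravector basis of `ℝ^{p+1}` inside `A`. -/
def εp (i : Fin (p + 1)) : A :=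
  if h : (i : ℕ) = 0 then 1 else gen p q ξ ⟨(i : ℕ) - 1, by have := i.isLt; omega⟩

/-- The 1-vector `∑ x_i e_{p+i} ∈ A` corresponding to `𝐱_q ∈ ℝ^q`;
for a unit `v` this is the imaginary unit `ω ∈ 𝕊`. -/
def ωCl (v : Vq q) : A := ∑ j, v j • eQ p q ξ j

/-- The paravector `x_0 + x_1 e_1 + ⋯ + x_p e_p ∈ A` of `𝐱_p ∈ ℝ^{p+1}`. -/
def clP (x : Vp p) : A := ∑ i, x i • εp p q ξ i

/-- The paravector of `𝐱 ∈ ℝ^{p+q+1}` in `A`. -/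
def toCl (z : V p q) : A := clP p q ξ z.1 + ωCl p q ξ z.2

section SliceOperators

variable {F' : Type*} [NormedAddCommGroup F'] [NormedSpace ℝ F']

/-- `∂_{x_i}` on functions on `ℝ^{p+2}`. -/
def pdSl (i : Fin (p + 1)) (F : Sl p → F') : Sl p → F' :=
  fun z => fderiv ℝ F z (Pi.single i 1, 0)

/-- `∂_r` on functions on `ℝ^{p+2}`. -/
def pdr (F : Sl p → F') : Sl p → F' := fun z => fderiv ℝ F z (0, 1)

/-- `∂_{x_i}` (first factor) on functions on `ℝ^{p+q+1}`. -/
def pdV1 (i : Fin (p + 1)) (f : V p q → F') : V p q → F' :=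
  fun z => fderiv ℝ f z ((Pi.single i 1 : Vp p), 0)

/-- `∂_{x_{p+j}}` (second factor) on functions on `ℝ^{p+q+1}`. -/
def pdV2 (j : Fin q) (f : V p q → F') : V p q → F' :=
  fun z => fderiv ℝ f z (0, EuclideanSpace.single j 1)

/-- `∂_{x_i}` on functions on `ℝ^{p+1}`. -/
def pdP (i : Fin (p + 1)) (g : Vp p → F') : Vp p → F' :=
  fun x => fderiv ℝ g x (Pi.single i 1)

/-- The Laplacian `Δ_{𝐱'} = Δ_{𝐱_p} + ∂_r²` on `ℝ^{p+2}`. -/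
def LapSl (F : Sl p → F') : Sl p → F' :=
  fun z => ∑ i, pdSl p (i := i) (pdSl p i F) z + pdr p (pdr p F) z

/-- The Laplacian `Δ_𝐱` on `ℝ^{p+q+1}`. -/
def LapV (f : V p q → F') : V p q → F' :=
  fun z => ∑ i, pdV1 p q i (pdV1 p q i f) z + ∑ j, pdV2 p q j (pdV2 p q j f) z

/-- The Laplacian `Δ_{𝐱_p}` on `ℝ^{p+1}`. -/
def LapP (g : Vp p → F') : Vp p → F' :=
  fun x => ∑ i, pdP p i (pdP p i g) x

end SliceOperators

/-- The generalized Cauchy–Riemann operator `D_{𝐱_p} = ∑_{i=0}^p e_i ∂_{x_i}`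
on slice functions. -/
def DP (F : Sl p → A) : Sl p → A :=
  fun z => ∑ i, εp p q ξ i * pdSl p i F z

/-- The conjugated operator `D̄_{𝐱_p} = ∂_{x_0} - ∑_{i=1}^p e_i ∂_{x_i}`. -/
def DPbar (F : Sl p → A) : Sl p → A :=
  fun z => pdSl p 0 F z - ∑ i : Fin p, eP p q ξ i * pdSl p i.succ F z

/-- The generalized Cauchy–Riemann (Dirac) operator `D_𝐱` on `ℝ^{p+q+1}`. -/
def DV (f : V p q → A) : V p q → A :=
  fun z => ∑ i, εp p q ξ i * pdV1 p q i f z + ∑ j, eQ p q ξ j * pdV2 p q j f z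

/-- `D_{𝐱_p} = ∑_{i=0}^p e_i ∂_{x_i}` on functions on `ℝ^{p+1}`. -/
def DPfun (g : Vp p → A) : Vp p → A :=
  fun x => ∑ i, εp p q ξ i * pdP p i g x

/-- The slice operator `D_ω = D_{𝐱_p} + ω ∂_r`, expressed on `ℝ^{p+q+1} ∖ ℝ^{p+1}`
(at `𝐱_q = 0` the radial part is junk `0`). -/
def Dslice (f : V p q → A) : V p q → A :=
  fun z => ∑ i, εp p q ξ i * pdV1 p q i f z
    + ωCl p q ξ (‖z.2‖⁻¹ • z.2) * fderiv ℝ f z (0, ‖z.2‖⁻¹ • z.2)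

/-- The spherical Dirac operator `Γ = -∑_{i<j} e_i e_j L_{ij}` on the `ℝ^q` variables. -/
def sphericalDirac (f : V p q → A) : V p q → A :=
  fun z => - ∑ i : Fin q, ∑ j : Fin q,
    if (i : ℕ) < (j : ℕ) then
      eQ p q ξ i * eQ p q ξ j *
        (z.2 i • pdV2 p q j f z - z.2 j • pdV2 p q i f z)
    else 0

/-- `f` is left generalized partial-slice monogenic of type `(p,q)` on `Ω`. -/
def GSMOn (Ω : Set (V p q)) (f : V p q → A) : Prop :=
  ∀ v ∈ S q,
    ContDiffOn ℝ 1 (fun z => f (spt p q v z)) (sliceSet p q Ω v) ∧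
    ∀ z ∈ sliceSet p q Ω v,
      DP p q ξ (fun w => f (spt p q v w)) z
        + ωCl p q ξ v * pdr p (fun w => f (spt p q v w)) z = 0

/-- `f` is (left) monogenic on `Ω`. -/
def MonogenicOn (Ω : Set (V p q)) (f : V p q → A) : Prop :=
  ContDiffOn ℝ 1 f Ω ∧ ∀ z ∈ Ω, DV p q ξ f z = 0

/-- `f` is the generalized partial-slice function on `Ω_D` with components `F1, F2`
(an even–odd pair in the last variable). -/
def IsGPSlice (D : Set (Sl p)) (f : V p q → A) (F1 F2 : Sl p → A) : Prop :=
  (∀ z ∈ D, F1 (z.1, -z.2) = F1 z ∧ F2 (z.1, -z.2) = -F2 z) ∧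
  ∀ z ∈ D, ∀ v ∈ S q, f (spt p q v z) = F1 z + ωCl p q ξ v * F2 z

/-- The generalized Cauchy–Riemann system (2.6) for the pair `(F1, F2)`. -/
def CRSystem (D : Set (Sl p)) (F1 F2 : Sl p → A) : Prop :=
  ∀ z ∈ D, DP p q ξ F1 z - pdr p F2 z = 0 ∧ DPbar p q ξ F2 z + pdr p F1 z = 0

/-- `f ∈ 𝒢𝒮ℛ(Ω_D)` with the given components. -/
def GSROnWith (D : Set (Sl p)) (f : V p q → A) (F1 F2 : Sl p → A) : Prop :=
  IsGPSlice p q ξ D f F1 F2 ∧ ContDiffOn ℝ 1 F1 D ∧ ContDiffOn ℝ 1 F2 D ∧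
    CRSystem p q ξ D F1 F2

/-- `f ∈ 𝒢𝒮ℛ(Ω_D)`. -/
def GSROn (D : Set (Sl p)) (f : V p q → A) : Prop :=
  ∃ F1 F2, GSROnWith p q ξ D f F1 F2

/-- Iterates `((1/r) ∂_r)^k F`. -/
def AIter (F : Sl p → A) : ℕ → Sl p → A
  | 0 => F
  | k + 1 => fun z => z.2⁻¹ • pdr p (AIter F k) z

/-- Iterates `(∂_r (1/r))^k F`. -/
def BIter (F : Sl p → A) : ℕ → Sl p → A
  | 0 => F
  | k + 1 => fun z => fderiv ℝ (fun w : Sl p => w.2⁻¹ • BIter F k w) z (0, 1)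

/-- `C_q(k) = (q-1)(q-3)⋯(q-2k+1)`. -/
def Cq (k : ℕ) : ℝ := ∏ j ∈ Finset.range k, ((q : ℝ) - (2 * (j : ℝ) + 1))

/-- The Fueter–Sce map `τ_q = (1/(q-1)!!) Δ^{(q-1)/2}` (for odd `q`). -/
def tauq (f : V p q → A) : V p q → A :=
  fun z => (((q - 1)‼ : ℝ))⁻¹ • (LapV p q)^[(q - 1) / 2] f z

/-- `(𝐱_q D_{𝐱_p})^k`, for a fixed Clifford element `u` in place of `𝐱_q`. -/
def uDpow (u : A) : ℕ → (Vp p → A) → Vp p → A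
  | 0 => fun g => g
  | k + 1 => fun g x => u * DPfun p q ξ (uDpow u k g) x

/-- The `k`-th term of the slice Cauchy–Kovalevskaya extension series. -/
def ckTerm (f₀ : Vp p → A) (k : ℕ) (z : V p q) : A :=
  ((k ! : ℝ))⁻¹ • uDpow p q ξ (ωCl p q ξ z.2) k f₀ z.1

/-- The slice Cauchy–Kovalevskaya extension `CK[f₀]`. -/
def CKext (f₀ : Vp p → A) (z : V p q) : A := ∑' k, ckTerm p q ξ f₀ k z

/-- The `k`-th term of the CK-extension for a fixed direction `w`. -/
def ckDirTerm (w : Vq q) (f₀ : Vp p → A) (k : ℕ) (z : V p q) : A :=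
  ((⟪w, z.2⟫) ^ k / (k ! : ℝ)) • uDpow p q ξ (ωCl p q ξ w) k f₀ z.1

/-- The CK-extension for a fixed direction `w ∈ 𝕊`. -/
def CKdir (w : Vq q) (f₀ : Vp p → A) (z : V p q) : A :=
  ∑' k, ckDirTerm p q ξ w f₀ k z

/-- The coefficients of the generalized CK-extension:
`f_{2k} = (Γ(q/2) / (2^{2k} k! Γ(k+q/2))) Δ^k f₀` and
`f_{2k+1} = (Γ(q/2) / (2^{2k+1} k! Γ(k+q/2+1))) D Δ^k f₀`. -/
def gckCoeff (f₀ : Vp p → A) (k : ℕ) : Vp p → A :=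
  if k % 2 = 0 then
    fun x => (Real.Gamma ((q : ℝ) / 2) /
        (2 ^ k * ((k / 2)! : ℝ) * Real.Gamma (((k / 2 : ℕ) : ℝ) + (q : ℝ) / 2))) •
      (LapP p)^[k / 2] f₀ x
  else
    fun x => (Real.Gamma ((q : ℝ) / 2) /
        (2 ^ k * ((k / 2)! : ℝ) * Real.Gamma (((k / 2 : ℕ) : ℝ) + (q : ℝ) / 2 + 1))) •
      DPfun p q ξ ((LapP p)^[k / 2] f₀) x

/-- The `k`-th term `𝐱_q^k f_k(𝐱_p)` of the generalized CK-extension series. -/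
def gckTerm (f₀ : Vp p → A) (k : ℕ) (z : V p q) : A :=
  (ωCl p q ξ z.2) ^ k * gckCoeff p q ξ f₀ k z.1

/-- The generalized CK-extension `GCK[f₀]`. -/
def GCKext (f₀ : Vp p → A) (z : V p q) : A := ∑' k, gckTerm p q ξ f₀ k z

/-- The Radon transform `R[f](𝐱_p, r, ω) = ∫_{⟨𝐱_q,ω⟩=r} f(𝐱_p, 𝐱_q) dσ(𝐱_q)`. -/
def radon (f : V p q → A) (x : Vp p) (r : ℝ) (w : Vq q) : A :=
  ∫ u : ((Submodule.span ℝ {w})ᗮ : Submodule ℝ (Vq q)),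
    f (x, r • w + (u : Vq q))

/-- The (suitably normalized) surface measure on the unit sphere of `ℝ^q`. -/
def sphMeasure : Measure (sphere (0 : Vq q) 1) := volume.toSphere

/-- The dual Radon transform
`Ř[f](𝐱_p, 𝐱_q) = (1/A_q) ∫_𝕊 f(𝐱_p, ⟨𝐱_q, η⟩ η) dS(η)` (a spherical average). -/
def dualRadon (f : V p q → A) (z : V p q) : A :=
  ⨍ w : sphere (0 : Vq q) 1,
    f (z.1, (⟪((w : Vq q)), z.2⟫) • (w : Vq q)) ∂(sphMeasure q)

end GPS

open GPS


namespace GPS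

open Set

section CauchyKernel

lemma differentiableOn_setIntegral_of_isCompact {X : Type*} [TopologicalSpace X] [T2Space X]
    [SecondCountableTopologyEither X ℂ]
    [MeasurableSpace X] [OpensMeasurableSpace X] {μ : Measure X} [IsFiniteMeasureOnCompacts μ]
    {U : Set ℂ} (hU : IsOpen U) {K : Set X} (hK : IsCompact K) {F F' : ℂ → X → ℂ}
    (hF : ContinuousOn (Function.uncurry F) (U ×ˢ K))
    (hF' : ContinuousOn (Function.uncurry F') (U ×ˢ K))
    (hderiv : ∀ t ∈ U, ∀ y ∈ K, HasDerivAt (fun s => F s y) (F' t y) t) :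
    DifferentiableOn ℂ (fun t => ∫ y in K, F t y ∂μ) U := by
  intro t₀ ht₀
  obtain ⟨ρ, hρ, hρU⟩ := Metric.nhds_basis_closedBall.mem_iff.1 (hU.mem_nhds ht₀)
  have hslice {G : ℂ → X → ℂ} (hG : ContinuousOn (Function.uncurry G) (U ×ˢ K)) {t : ℂ}
      (ht : t ∈ U) : ContinuousOn (G t) K :=
    hG.comp (f := fun y => (t, y)) (by fun_prop) fun y hy => ⟨ht, hy⟩
  obtain ⟨C, hC⟩ := ((isCompact_closedBall t₀ ρ).prod hK).exists_bound_of_continuousOn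
    (hF'.mono (prod_mono hρU subset_rfl))
  have hmem : ∀ᵐ y ∂μ.restrict K, y ∈ K := ae_restrict_mem hK.measurableSet
  have : IsFiniteMeasure (μ.restrict K) := ⟨by simpa using hK.measure_lt_top⟩
  refine (hasDerivAt_integral_of_dominated_loc_of_deriv_le (F := F) (F' := F')
    (bound := fun _ => C) (ball_mem_nhds t₀ hρ) ?_ ?_ ?_ ?_ (integrable_const C) ?_).2
      |>.differentiableAt.differentiableWithinAt
  · filter_upwards [hU.mem_nhds ht₀] with t ht
    exact (hslice hF ht).aestronglyMeasurable hK.measurableSet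
  · exact (hslice hF ht₀).integrableOn_compact hK
  · exact (hslice hF' ht₀).aestronglyMeasurable hK.measurableSet
  · filter_upwards [hmem] with y hy t ht
    exact hC (t, y) ⟨ball_subset_closedBall ht, hy⟩
  · filter_upwards [hmem] with y hy t ht
    exact hderiv t (hρU (ball_subset_closedBall ht)) y hy

variable {ι : Type*} [Fintype ι]

/-- The regularised Cauchy kernel component `(y - x)ᵢ (‖y - x‖² + ε)^s`. -/
def cauchyKernel (s ε : ℝ) (x : EuclideanSpace ℝ ι) (i : ι) (y : EuclideanSpace ℝ ι) : ℝ :=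
  (y i - x i) * (‖y - x‖ ^ 2 + ε) ^ s

lemma analyticAt_integral_cauchyKernel (s : ℝ) (i : ι) {G : EuclideanSpace ℝ ι → ℝ}
    (hG : Continuous G) (hGc : HasCompactSupport G) {a : EuclideanSpace ℝ ι} {δ : ℝ}
    (hδ : 0 < δ) (hG0 : ∀ y ∈ ball a δ, G y = 0) (v : EuclideanSpace ℝ ι) :
    AnalyticAt ℝ (fun t : ℝ => ∫ y, cauchyKernel s 0 (a + t • v) i y * G y) 0 := by
  set K := tsupport G with hKdef
  have hK : IsCompact K := hGc
  have hKa : ∀ y ∈ K, δ ≤ ‖y - a‖ := by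
    have : K ⊆ (ball a δ)ᶜ := by
      refine closure_minimal (fun y hy hya => hy (hG0 y hya)) isOpen_ball.isClosed_compl
    intro y hy
    simpa [dist_eq_norm] using this hy
  set ρ := δ / (4 * (‖v‖ + 1)) with hρdef
  have hv := norm_nonneg v
  have hρ : 0 < ρ := by positivity
  have hρv : ρ * ‖v‖ ≤ δ / 4 := by
    rw [hρdef, div_mul_eq_mul_div, div_le_div_iff₀ (by positivity) (by norm_num)]
    nlinarith
  let q : ℂ → EuclideanSpace ℝ ι → ℂ := fun t y =>
    ((‖y - a‖ ^ 2 : ℝ) : ℂ) - 2 * t * ((⟪y - a, v⟫ : ℝ) : ℂ) + t ^ 2 * ((‖v‖ ^ 2 : ℝ) : ℂ)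
  have hq : ∀ t ∈ ball (0 : ℂ) ρ, ∀ y ∈ K, q t y ∈ Complex.slitPlane := by
    intro t ht y hy
    left
    have ht' : ‖t‖ ≤ ρ := by simpa using (mem_ball_zero_iff.1 ht).le
    have h1 : ‖t‖ * ‖v‖ ≤ δ / 4 := (mul_le_mul_of_nonneg_right ht' hv).trans hρv
    have hR := hKa y hy
    have h2 : |⟪y - a, v⟫| ≤ ‖y - a‖ * ‖v‖ := abs_real_inner_le_norm _ _
    have h3 : |t.re * ⟪y - a, v⟫| ≤ ‖t‖ * (‖y - a‖ * ‖v‖) := by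
      rw [abs_mul]
      exact mul_le_mul (Complex.abs_re_le_norm t) h2 (abs_nonneg _) (norm_nonneg _)
    have h4 : |(t ^ 2).re| ≤ ‖t‖ ^ 2 := (Complex.abs_re_le_norm _).trans_eq (norm_pow t 2)
    have h5 : (q t y).re
        = ‖y - a‖ ^ 2 - 2 * (t.re * ⟪y - a, v⟫) + (t ^ 2).re * ‖v‖ ^ 2 := by
      simp only [q, Complex.add_re, Complex.sub_re, Complex.re_mul_ofReal, Complex.ofReal_re]
      simp [mul_assoc]
    rw [h5]
    have h6 := (abs_le.1 h3).2
    have h7 : -(‖t‖ ^ 2 * ‖v‖ ^ 2) ≤ (t ^ 2).re * ‖v‖ ^ 2 := by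
      nlinarith [(abs_le.1 h4).1, sq_nonneg ‖v‖]
    have h8 : 0 ≤ ‖t‖ * ‖v‖ := by positivity
    nlinarith
  let F : ℂ → EuclideanSpace ℝ ι → ℂ := fun t y =>
    ((y i - a i : ℝ) - t * (v i : ℝ)) * q t y ^ (s : ℂ) * (G y : ℂ)
  let F' : ℂ → EuclideanSpace ℝ ι → ℂ := fun t y =>
    (-(v i : ℂ) * q t y ^ (s : ℂ) + ((y i - a i : ℝ) - t * (v i : ℝ)) *
      ((s : ℂ) * q t y ^ ((s : ℂ) - 1) *
        (-2 * ((⟪y - a, v⟫ : ℝ) : ℂ) + 2 * t * ((‖v‖ ^ 2 : ℝ) : ℂ)))) * (G y : ℂ)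
  have hqc : Continuous (Function.uncurry q) := by
    simp only [q, Function.uncurry_def]
    fun_prop
  have hpow : ∀ c : ℂ, ContinuousOn (fun z : ℂ × EuclideanSpace ℝ ι => q z.1 z.2 ^ c)
      (ball 0 ρ ×ˢ K) := fun c =>
    ContinuousOn.cpow_const (f := fun z : ℂ × EuclideanSpace ℝ ι => q z.1 z.2)
      hqc.continuousOn fun z hz => hq z.1 hz.1 z.2 hz.2
  have hdiff : DifferentiableOn ℂ (fun t => ∫ y in K, F t y) (ball 0 ρ) := by
    refine differentiableOn_setIntegral_of_isCompact isOpen_ball hK (F' := F') ?_ ?_ ?_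
    · simp only [F, Function.uncurry_def]
      exact (ContinuousOn.mul (by fun_prop) (hpow s)).mul (by fun_prop)
    · simp only [F', Function.uncurry_def]
      refine ContinuousOn.mul (.add (.mul (by fun_prop) (hpow s)) (.mul (by fun_prop)
        (.mul (.mul (by fun_prop) (hpow _)) ?_))) (by fun_prop)
      fun_prop
    · intro t ht y hy
      have hq' : HasDerivAt (fun t => q t y)
          (-2 * ((⟪y - a, v⟫ : ℝ) : ℂ) + 2 * t * ((‖v‖ ^ 2 : ℝ) : ℂ)) t := by
        have := (((hasDerivAt_id t).const_mul 2).mul_const ((⟪y - a, v⟫ : ℝ) : ℂ)).const_sub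
          ((‖y - a‖ ^ 2 : ℝ) : ℂ) |>.add
          (((hasDerivAt_id t).pow 2).mul_const ((‖v‖ ^ 2 : ℝ) : ℂ))
        refine this.congr_deriv ?_
        simp
      have hl : HasDerivAt (fun t : ℂ => ((y i - a i : ℝ) : ℂ) - t * ((v i : ℝ) : ℂ))
          (-(v i : ℂ)) t := by
        simpa using ((hasDerivAt_id t).mul_const ((v i : ℝ) : ℂ)).const_sub
          ((y i - a i : ℝ) : ℂ)
      exact ((hl.mul (hq'.cpow_const (hq t ht y hy))).mul_const (G y : ℂ))
  have han : AnalyticAt ℂ (fun t => ∫ y in K, F t y) ((0 : ℝ) : ℂ) :=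
    hdiff.analyticAt (by simpa using ball_mem_nhds (0 : ℂ) hρ)
  have hre : AnalyticAt ℝ (fun t : ℝ => (∫ y in K, F t y).re) 0 := han.re_ofReal
  refine hre.congr ?_
  filter_upwards [ball_mem_nhds (0 : ℝ) hρ] with t ht
  have hint : ∫ y, cauchyKernel s 0 (a + t • v) i y * G y
      = ∫ y in K, cauchyKernel s 0 (a + t • v) i y * G y := by
    refine (setIntegral_eq_integral_of_forall_compl_eq_zero fun y hy => ?_).symm
    rw [image_eq_zero_of_notMem_tsupport hy, mul_zero]
  have hcong : ∫ y in K, F t y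
      = ∫ y in K, ((cauchyKernel s 0 (a + t • v) i y * G y : ℝ) : ℂ) := by
    refine setIntegral_congr_fun hK.measurableSet fun y _ => ?_
    have hqr : q t y = ((‖y - (a + t • v)‖ ^ 2 : ℝ) : ℂ) := by
      have : ‖y - (a + t • v)‖ ^ 2 = ‖y - a‖ ^ 2 - 2 * t * ⟪y - a, v⟫ + t ^ 2 * ‖v‖ ^ 2 := by
        rw [← sub_sub, norm_sub_sq_real, inner_smul_right, norm_smul, mul_pow, Real.norm_eq_abs,
          sq_abs]
        ring
      rw [this]
      simp [q]
    simp only [F, hqr, cauchyKernel, add_zero]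
    rw [← Complex.ofReal_cpow (by positivity)]
    simp only [PiLp.add_apply, PiLp.smul_apply, smul_eq_mul]
    push_cast
    ring
  rw [hint, hcong, integral_complex_ofReal, Complex.ofReal_re]

lemma continuous_cauchyKernel (s : ℝ) {ε : ℝ} (hε : 0 < ε) (x : EuclideanSpace ℝ ι) (i : ι) :
    Continuous (cauchyKernel s ε x i) := by
  unfold cauchyKernel
  refine Continuous.mul (by fun_prop) (Continuous.rpow_const (by fun_prop) fun y => Or.inl ?_)
  positivity

lemma hasFDerivAt_cauchyKernel (s : ℝ) {ε : ℝ} (hε : 0 < ε) (x : EuclideanSpace ℝ ι) (i : ι)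
    (y : EuclideanSpace ℝ ι) :
    HasFDerivAt (cauchyKernel s ε x i)
      ((y i - x i) • ((s * (‖y - x‖ ^ 2 + ε) ^ (s - 1)) • (2 • innerSL ℝ (y - x)))
        + ((‖y - x‖ ^ 2 + ε) ^ s) • EuclideanSpace.proj (𝕜 := ℝ) i) y := by
  have h1 : HasFDerivAt (fun y : EuclideanSpace ℝ ι => y i - x i)
      (EuclideanSpace.proj (𝕜 := ℝ) i) y :=
    (EuclideanSpace.proj (𝕜 := ℝ) i).hasFDerivAt.sub_const _
  have h2 : HasFDerivAt (fun y : EuclideanSpace ℝ ι => ‖y - x‖ ^ 2 + ε)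
      (2 • innerSL ℝ (y - x)) y := by
    simpa using ((hasFDerivAt_id y).sub_const x).norm_sq.add_const ε
  exact h1.mul (h2.rpow_const (p := s) (Or.inl (by positivity)))

lemma fderiv_cauchyKernel_single [DecidableEq ι] (s : ℝ) {ε : ℝ} (hε : 0 < ε)
    (x : EuclideanSpace ℝ ι) (i j : ι) (y : EuclideanSpace ℝ ι) :
    fderiv ℝ (cauchyKernel s ε x i) y (EuclideanSpace.single j 1)
      = 2 * s * (‖y - x‖ ^ 2 + ε) ^ (s - 1) * ((y i - x i) * (y j - x j))
        + if i = j then (‖y - x‖ ^ 2 + ε) ^ s else 0 := by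
  rw [(hasFDerivAt_cauchyKernel s hε x i y).fderiv]
  simp [EuclideanSpace.inner_single_right]
  ring

lemma integral_cauchyKernel_mul_fderiv [DecidableEq ι] {ε : ℝ} (hε : 0 < ε)
    (x : EuclideanSpace ℝ ι)
    {W : ι → ι → EuclideanSpace ℝ ι → ℝ} {H : EuclideanSpace ℝ ι → ℝ}
    (hW : ∀ i j, ContDiff ℝ 1 (W i j)) (hWc : ∀ i j, HasCompactSupport (W i j))
    (hWH : ∀ i j y, W i j y + W j i y = if i = j then 2 * H y else 0) :
    ∑ i, ∫ y, cauchyKernel (-(Fintype.card ι / 2 : ℝ)) ε x i y *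
        ∑ j, fderiv ℝ (W i j) y (EuclideanSpace.single j 1)
      = -∫ y, (Fintype.card ι * ε) *
          (‖y - x‖ ^ 2 + ε) ^ (-(Fintype.card ι / 2 : ℝ) - 1) * H y := by
  set s : ℝ := -(Fintype.card ι / 2 : ℝ) with hs
  have hcard : (Fintype.card ι : ℝ) = -(2 * s) := by rw [hs]; ring
  have hk := continuous_cauchyKernel s hε x
  have hk' : ∀ i j, Continuous fun y =>
      fderiv ℝ (cauchyKernel s ε x i) y (EuclideanSpace.single j 1) := by
    intro i j
    simp only [fderiv_cauchyKernel_single s hε]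
    have hp : ∀ c : ℝ, Continuous fun y : EuclideanSpace ℝ ι => (‖y - x‖ ^ 2 + ε) ^ c :=
      fun c => Continuous.rpow_const (by fun_prop) fun y => Or.inl (by positivity)
    have h1 := hp s
    have h2 := hp (s - 1)
    split_ifs <;> fun_prop
  have hWf : ∀ i j, Continuous fun y => fderiv ℝ (W i j) y (EuclideanSpace.single j 1) :=
    fun i j => ((hW i j).continuous_fderiv one_ne_zero).clm_apply continuous_const
  have hWfc : ∀ i j, HasCompactSupport fun y =>
      fderiv ℝ (W i j) y (EuclideanSpace.single j 1) :=
    fun i j => (hWc i j).fderiv_apply ℝ _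
  have i1 : ∀ i j, Integrable fun y => cauchyKernel s ε x i y *
      fderiv ℝ (W i j) y (EuclideanSpace.single j 1) := fun i j =>
    ((hk i).mul (hWf i j)).integrable_of_hasCompactSupport (hWfc i j).mul_left
  have i2 : ∀ i j, Integrable fun y =>
      fderiv ℝ (cauchyKernel s ε x i) y (EuclideanSpace.single j 1) * W i j y := fun i j =>
    ((hk' i j).mul (hW i j).continuous).integrable_of_hasCompactSupport (hWc i j).mul_left
  have i3 : ∀ i j, Integrable fun y => cauchyKernel s ε x i y * W i j y := fun i j =>
    ((hk i).mul (hW i j).continuous).integrable_of_hasCompactSupport (hWc i j).mul_left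
  have hibp : ∀ i j, ∫ y, cauchyKernel s ε x i y *
        fderiv ℝ (W i j) y (EuclideanSpace.single j 1)
      = -∫ y, fderiv ℝ (cauchyKernel s ε x i) y (EuclideanSpace.single j 1) * W i j y :=
    fun i j => integral_mul_fderiv_eq_neg_fderiv_mul_of_integrable (i2 i j) (i1 i j) (i3 i j)
      (fun y _ => (hasFDerivAt_cauchyKernel s hε x i y).differentiableAt)
      (fun y _ => ((hW i j).differentiable one_ne_zero) y)
  have hpt : ∀ y, ∑ i, ∑ j,
      fderiv ℝ (cauchyKernel s ε x i) y (EuclideanSpace.single j 1) * W i j y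
      = (Fintype.card ι * ε) * (‖y - x‖ ^ 2 + ε) ^ (s - 1) * H y := by
    intro y
    have hsymm : ∀ i j, fderiv ℝ (cauchyKernel s ε x i) y (EuclideanSpace.single j 1)
        = fderiv ℝ (cauchyKernel s ε x j) y (EuclideanSpace.single i 1) := by
      intro i j
      simp only [fderiv_cauchyKernel_single s hε, eq_comm (a := i) (b := j)]
      ring
    have hpos : 0 < ‖y - x‖ ^ 2 + ε := by positivity
    set T := ∑ i, ∑ j,
      fderiv ℝ (cauchyKernel s ε x i) y (EuclideanSpace.single j 1) * W i j y with hT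
    have hT2 : T = ∑ i, ∑ j,
        fderiv ℝ (cauchyKernel s ε x i) y (EuclideanSpace.single j 1) * W j i y := by
      rw [hT, Finset.sum_comm]
      exact Finset.sum_congr rfl fun i _ => Finset.sum_congr rfl fun j _ => by rw [hsymm]
    have hsum : T + T = ∑ i, 2 *
        (fderiv ℝ (cauchyKernel s ε x i) y (EuclideanSpace.single i 1) * H y) := by
      nth_rewrite 1 [hT]
      rw [hT2, ← Finset.sum_add_distrib]
      refine Finset.sum_congr rfl fun i _ => ?_
      rw [← Finset.sum_add_distrib]
      simp only [← mul_add, hWH, mul_ite, mul_zero, Finset.sum_ite_eq, Finset.mem_univ, if_true]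
      ring
    have hdiv : ∑ i, fderiv ℝ (cauchyKernel s ε x i) y (EuclideanSpace.single i 1)
        = (Fintype.card ι * ε) * (‖y - x‖ ^ 2 + ε) ^ (s - 1) := by
      simp only [fderiv_cauchyKernel_single s hε, if_true, Finset.sum_add_distrib,
        ← Finset.mul_sum, Finset.sum_const, Finset.card_univ, nsmul_eq_mul]
      have hn : ∑ i, (y i - x i) * (y i - x i) = ‖y - x‖ ^ 2 := by
        rw [EuclideanSpace.real_norm_sq_eq]
        simp [sq]
      have hr : (‖y - x‖ ^ 2 + ε) ^ s = (‖y - x‖ ^ 2 + ε) ^ (s - 1) * (‖y - x‖ ^ 2 + ε) := by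
        rw [← Real.rpow_add_one hpos.ne']; ring_nf
      rw [hn, hr, hcard]
      ring
    rw [← Finset.mul_sum, ← Finset.sum_mul, hdiv] at hsum
    linarith
  calc _ = ∑ i, ∑ j, ∫ y, cauchyKernel s ε x i y *
        fderiv ℝ (W i j) y (EuclideanSpace.single j 1) := by
        refine Finset.sum_congr rfl fun i _ => ?_
        simp only [Finset.mul_sum]
        exact integral_finsetSum _ fun j _ => i1 i j
    _ = -∫ y, ∑ i, ∑ j,
        fderiv ℝ (cauchyKernel s ε x i) y (EuclideanSpace.single j 1) * W i j y := by
        rw [integral_finsetSum _ fun i _ => integrable_finsetSum _ fun j _ => i2 i j]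
        simp only [integral_finsetSum _ fun j _ => i2 _ j, hibp, Finset.sum_neg_distrib]
    _ = _ := by simp only [hpt]

/-- The mass of the limiting Dirac kernel. -/
def cauchyMass (ι : Type*) [Fintype ι] : ℝ :=
  ∫ z : EuclideanSpace ℝ ι, (Fintype.card ι : ℝ) *
    (‖z‖ ^ 2 + 1) ^ (-(Fintype.card ι / 2 : ℝ) - 1)

lemma integrable_cauchyMass (ι : Type*) [Fintype ι] :
    Integrable fun z : EuclideanSpace ℝ ι => (Fintype.card ι : ℝ) *
      (‖z‖ ^ 2 + 1) ^ (-(Fintype.card ι / 2 : ℝ) - 1) := by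
  have h := integrable_rpow_neg_one_add_norm_sq (E := EuclideanSpace ℝ ι) (μ := volume)
    (r := Fintype.card ι + 2) (by simp)
  refine (h.const_mul (Fintype.card ι : ℝ)).congr (.of_forall fun z => ?_)
  simp only [add_comm (1 : ℝ)]
  ring_nf

lemma cauchyMass_pos (ι : Type*) [Fintype ι] [Nonempty ι] : 0 < cauchyMass ι := by
  have hc : (0 : ℝ) < Fintype.card ι := by exact_mod_cast Fintype.card_pos
  refine (integral_pos_iff_support_of_nonneg (fun z => by positivity)
    (integrable_cauchyMass ι)).2 ?_
  have hsupp : Function.support (fun z : EuclideanSpace ℝ ι => (Fintype.card ι : ℝ) *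
      (‖z‖ ^ 2 + 1) ^ (-(Fintype.card ι / 2 : ℝ) - 1)) = univ :=
    eq_univ_of_forall fun z => ne_of_gt (by positivity)
  rw [hsupp]
  exact isOpen_univ.measure_pos _ univ_nonempty

lemma tendsto_integral_dirac [Nonempty ι] (x : EuclideanSpace ℝ ι) {H : EuclideanSpace ℝ ι → ℝ}
    (hH : Continuous H) (hHc : HasCompactSupport H) :
    Tendsto (fun ε : ℝ => ∫ y, (Fintype.card ι * ε) *
          (‖y - x‖ ^ 2 + ε) ^ (-(Fintype.card ι / 2 : ℝ) - 1) * H y)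
      (𝓝[>] 0) (𝓝 (cauchyMass ι * H x)) := by
  set n : ℝ := (Fintype.card ι : ℝ) with hn
  have hscale : ∀ ε > 0, ∫ y, (n * ε) * (‖y - x‖ ^ 2 + ε) ^ (-(n / 2) - 1) * H y
      = ∫ z, n * (‖z‖ ^ 2 + 1) ^ (-(n / 2) - 1) * H (x + √ε • z) := by
    intro ε hε
    have h1 := integral_add_left_eq_self (μ := (volume : Measure (EuclideanSpace ℝ ι)))
      (fun y => (n * ε) * (‖y - x‖ ^ 2 + ε) ^ (-(n / 2) - 1) * H y) x
    have h2 := Measure.integral_comp_smul (volume : Measure (EuclideanSpace ℝ ι))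
      (fun z => (n * ε) * (‖x + z - x‖ ^ 2 + ε) ^ (-(n / 2) - 1) * H (x + z)) (√ε)
    have hsq : 0 < √ε := Real.sqrt_pos.2 hε
    have hpow : √ε ^ Fintype.card ι = ε ^ (n / 2) := by
      rw [← Real.rpow_natCast, Real.sqrt_eq_rpow, ← Real.rpow_mul hε.le, hn]
      ring_nf
    rw [← h1]
    rw [finrank_euclideanSpace, abs_of_pos (by positivity), smul_eq_mul, eq_comm,
      inv_mul_eq_iff_eq_mul₀ (by positivity), hpow, ← integral_const_mul] at h2
    rw [h2]
    refine integral_congr_ae (.of_forall fun z => ?_)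
    have h3 : ‖x + √ε • z - x‖ ^ 2 + ε = ε * (‖z‖ ^ 2 + 1) := by
      rw [add_sub_cancel_left, norm_smul, mul_pow, Real.norm_eq_abs, sq_abs,
        Real.sq_sqrt hε.le]
      ring
    have h4 : ε ^ (n / 2) * ε ^ (-(n / 2) - 1) * ε = 1 := by
      rw [← Real.rpow_add hε, ← Real.rpow_add_one hε.ne',
        show n / 2 + (-(n / 2) - 1) + 1 = 0 by ring, Real.rpow_zero]
    beta_reduce
    rw [h3, Real.mul_rpow hε.le (by positivity)]
    linear_combination (n * (‖z‖ ^ 2 + 1) ^ (-(n / 2) - 1) * H (x + √ε • z)) * h4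
  obtain ⟨C, hC⟩ := hHc.exists_bound_of_continuous hH
  have hlim : Tendsto (fun ε : ℝ => ∫ z, n * (‖z‖ ^ 2 + 1) ^ (-(n / 2) - 1) * H (x + √ε • z))
      (𝓝[>] 0) (𝓝 (∫ z : EuclideanSpace ℝ ι, n * (‖z‖ ^ 2 + 1) ^ (-(n / 2) - 1) * H x)) := by
    refine tendsto_integral_filter_of_dominated_convergence
      (fun z => (n * (‖z‖ ^ 2 + 1) ^ (-(n / 2) - 1)) * C) (.of_forall fun ε => ?_)
      (.of_forall fun ε => .of_forall fun z => ?_)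
      ((integrable_cauchyMass ι).mul_const C) (.of_forall fun z => ?_)
    · exact (integrable_cauchyMass ι).aestronglyMeasurable.mul
        (Continuous.aestronglyMeasurable (by fun_prop))
    · rw [norm_mul, Real.norm_of_nonneg (by positivity)]
      exact mul_le_mul_of_nonneg_left (hC _) (by positivity)
    · refine Tendsto.const_mul _ ?_
      have : Continuous fun ε : ℝ => H (x + √ε • z) := by fun_prop
      simpa using (this.tendsto 0).mono_left nhdsWithin_le_nhds
  rw [integral_mul_const] at hlim
  refine hlim.congr' ?_
  filter_upwards [self_mem_nhdsWithin] with ε hε using (hscale ε hε).symm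

lemma tendsto_integral_cauchyKernel {s : ℝ} (hs : s ≤ 0) (x : EuclideanSpace ℝ ι) (i : ι)
    {G : EuclideanSpace ℝ ι → ℝ} (hG : Continuous G) (hGc : HasCompactSupport G) {δ : ℝ}
    (hδ : 0 < δ) (hG0 : ∀ y ∈ ball x δ, G y = 0) :
    Tendsto (fun ε : ℝ => ∫ y, cauchyKernel s ε x i y * G y) (𝓝[>] 0)
      (𝓝 (∫ y, cauchyKernel s 0 x i y * G y)) := by
  have hint : Integrable fun y => |y i - x i| * (δ ^ 2) ^ s * |G y| :=
    Continuous.integrable_of_hasCompactSupport (by fun_prop) hGc.abs.mul_left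
  refine tendsto_integral_filter_of_dominated_convergence _ ?_ ?_ hint ?_
  · filter_upwards [self_mem_nhdsWithin] with ε hε
    exact ((continuous_cauchyKernel s hε x i).mul hG).aestronglyMeasurable
  · filter_upwards [self_mem_nhdsWithin] with ε hε
    refine .of_forall fun y => ?_
    by_cases hy : y ∈ ball x δ
    · simp [hG0 y hy]
    have hε' : 0 < ε := hε
    have hd : δ ≤ ‖y - x‖ := by simpa [dist_eq_norm] using hy
    rw [norm_mul, cauchyKernel, norm_mul, Real.norm_eq_abs, Real.norm_eq_abs, Real.norm_eq_abs,
      abs_of_nonneg (a := _ ^ s) (by positivity)]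
    gcongr ?_ * ?_ * ?_
    refine Real.rpow_le_rpow_of_nonpos (by positivity) ?_ hs
    nlinarith
  · refine .of_forall fun y => ?_
    by_cases hy : y ∈ ball x δ
    · simp [hG0 y hy]
    have hd : δ ≤ ‖y - x‖ := by simpa [dist_eq_norm] using hy
    have hpos : 0 < ‖y - x‖ := hδ.trans_le hd
    refine Tendsto.mul_const _ (Tendsto.const_mul _ ?_)
    refine tendsto_nhdsWithin_of_tendsto_nhds ?_
    refine Tendsto.rpow_const ?_ (Or.inl (by positivity))
    exact (continuous_const.add continuous_id).tendsto 0

lemma hasCompactSupport_divergence [DecidableEq ι] {W : ι → EuclideanSpace ℝ ι → ℝ}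
    (hW : ∀ j, HasCompactSupport (W j)) :
    HasCompactSupport fun y => ∑ j, fderiv ℝ (W j) y (EuclideanSpace.single j 1) := by
  refine HasCompactSupport.intro
    (isCompact_iUnion fun j => (hW j).fderiv_apply ℝ (EuclideanSpace.single j 1)) fun y hy =>
      Finset.sum_eq_zero fun j _ => ?_
  exact image_eq_zero_of_notMem_tsupport
    (f := fun y => fderiv ℝ (W j) y (EuclideanSpace.single j 1))
    fun hj => hy (mem_iUnion.2 ⟨j, hj⟩)

/-- A Cauchy integral formula for systems `W` whose symmetric part is scalar. -/
lemma cauchyMass_mul_eq [Nonempty ι] [DecidableEq ι] (x : EuclideanSpace ℝ ι)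
    {W : ι → ι → EuclideanSpace ℝ ι → ℝ} {H : EuclideanSpace ℝ ι → ℝ}
    (hW : ∀ i j, ContDiff ℝ 1 (W i j)) (hWc : ∀ i j, HasCompactSupport (W i j))
    (hWH : ∀ i j y, W i j y + W j i y = if i = j then 2 * H y else 0)
    {δ : ℝ} (hδ : 0 < δ)
    (h0 : ∀ i, ∀ y ∈ ball x δ, ∑ j, fderiv ℝ (W i j) y (EuclideanSpace.single j 1) = 0) :
    cauchyMass ι * H x = -∑ i, ∫ y, cauchyKernel (-(Fintype.card ι / 2 : ℝ)) 0 x i y *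
        ∑ j, fderiv ℝ (W i j) y (EuclideanSpace.single j 1) := by
  obtain ⟨i₀⟩ := ‹Nonempty ι›
  have hHW : H = W i₀ i₀ := by
    funext y
    have := hWH i₀ i₀ y
    simp only [if_true] at this
    linarith
  have hWf : ∀ i j, Continuous fun y => fderiv ℝ (W i j) y (EuclideanSpace.single j 1) :=
    fun i j => ((hW i j).continuous_fderiv one_ne_zero).clm_apply continuous_const
  have hG : ∀ i, Continuous fun y => ∑ j, fderiv ℝ (W i j) y (EuclideanSpace.single j 1) :=
    fun i => continuous_finsetSum _ fun j _ => hWf i j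
  have h1 := tendsto_finsetSum Finset.univ fun i (_ : i ∈ Finset.univ) =>
    tendsto_integral_cauchyKernel (s := -(Fintype.card ι / 2 : ℝ))
      (neg_nonpos.2 (by positivity)) x i (hG i) (hasCompactSupport_divergence (hWc i)) hδ (h0 i)
  have : Nonempty ι := ⟨i₀⟩
  have h2 := (tendsto_integral_dirac x (hHW ▸ (hW i₀ i₀).continuous) (hHW ▸ hWc i₀ i₀)).neg
  have h3 := tendsto_nhds_unique_of_eventuallyEq h1 h2 (by
    filter_upwards [self_mem_nhdsWithin] with ε hε
    exact integral_cauchyKernel_mul_fderiv hε x hW hWc hWH)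
  rw [h3, neg_neg]

/-- Components of a solution of a Dirac-type system are real analytic along lines. -/
lemma analyticAt_line_of_divergence_free [Nonempty ι] [DecidableEq ι]
    {Ω : Set (EuclideanSpace ℝ ι)} (hΩ : IsOpen Ω)
    {W : ι → ι → EuclideanSpace ℝ ι → ℝ} {H : EuclideanSpace ℝ ι → ℝ}
    (hW : ∀ i j, ContDiffOn ℝ 1 (W i j) Ω)
    (hWH : ∀ i j y, W i j y + W j i y = if i = j then 2 * H y else 0)
    (hdiv : ∀ i, ∀ y ∈ Ω, ∑ j, fderiv ℝ (W i j) y (EuclideanSpace.single j 1) = 0)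
    {a : EuclideanSpace ℝ ι} (ha : a ∈ Ω) (v : EuclideanSpace ℝ ι) :
    AnalyticAt ℝ (fun t : ℝ => H (a + t • v)) 0 := by
  obtain ⟨R, hR, hRΩ⟩ := Metric.nhds_basis_closedBall.mem_iff.1 (hΩ.mem_nhds ha)
  let χ : ContDiffBump a := ⟨R / 2, R, by positivity, by linarith⟩
  let W' : ι → ι → EuclideanSpace ℝ ι → ℝ := fun i j y => χ y * W i j y
  have hχΩ : tsupport χ ⊆ Ω := by rw [χ.tsupport_eq]; exact hRΩ
  have hW' : ∀ i j, ContDiff ℝ 1 (W' i j) := fun i j =>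
    contDiff_iff_contDiffAt.2 fun y => by
      by_cases hy : y ∈ tsupport χ
      · exact χ.contDiffAt.mul ((hW i j).contDiffAt (hΩ.mem_nhds (hχΩ hy)))
      · refine contDiffAt_const (c := (0 : ℝ)) |>.congr_of_eventuallyEq ?_
        filter_upwards [notMem_tsupport_iff_eventuallyEq.1 hy] with z hz
        simp [W', hz]
  have hWc : ∀ i j, HasCompactSupport (W' i j) := fun i j => χ.hasCompactSupport.mul_right
  have hWH' : ∀ i j y, W' i j y + W' j i y = if i = j then 2 * (χ y * H y) else 0 := by
    intro i j y
    simp only [W']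
    rw [← mul_add, hWH]
    split_ifs <;> ring
  let G : ι → EuclideanSpace ℝ ι → ℝ := fun i y =>
    ∑ j, fderiv ℝ (W' i j) y (EuclideanSpace.single j 1)
  have hone : ∀ y ∈ ball a (R / 2), χ y = 1 := fun y hy =>
    χ.one_of_mem_closedBall (ball_subset_closedBall hy)
  have hG0 : ∀ i, ∀ y ∈ ball a (R / 2), G i y = 0 := by
    intro i y hy
    rw [← hdiv i y (hRΩ (ball_subset_closedBall (ball_subset_ball (by linarith) hy)))]
    refine Finset.sum_congr rfl fun j _ => ?_
    have : W' i j =ᶠ[𝓝 y] W i j := by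
      filter_upwards [isOpen_ball.mem_nhds hy] with z hz
      simp [W', hone z hz]
    rw [this.fderiv_eq]
  have hG : ∀ i, Continuous (G i) := fun i => continuous_finsetSum _ fun j _ =>
    ((hW' i j).continuous_fderiv one_ne_zero).clm_apply continuous_const
  have hGc : ∀ i, HasCompactSupport (G i) := fun i => hasCompactSupport_divergence (hWc i)
  have hmain : AnalyticAt ℝ (fun t : ℝ => (cauchyMass ι)⁻¹ * -∑ i,
      ∫ y, cauchyKernel (-(Fintype.card ι / 2 : ℝ)) 0 (a + t • v) i y * G i y) 0 :=
    analyticAt_const.mul (Finset.analyticAt_fun_sum _ fun i _ =>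
      analyticAt_integral_cauchyKernel _ i (hG i) (hGc i) (half_pos hR) (hG0 i) v).neg
  refine hmain.congr ?_
  have hnear : ∀ᶠ t : ℝ in 𝓝 0, a + t • v ∈ ball a (R / 4) := by
    have : Continuous fun t : ℝ => a + t • v := by fun_prop
    exact this.continuousAt.eventually_mem (by simpa using ball_mem_nhds a (by positivity))
  filter_upwards [hnear] with t ht
  have h := cauchyMass_mul_eq (a + t • v) hW' hWc hWH' (δ := R / 4) (by positivity)
    fun i y hy => hG0 i y (by
      rw [mem_ball] at ht hy ⊢
      linarith [dist_triangle y (a + t • v) a])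
  rw [hone _ (ball_subset_ball (by linarith) ht), one_mul] at h
  rw [← h, inv_mul_cancel_left₀ (cauchyMass_pos ι).ne']

variable {A : Type*} [NormedRing A] [NormedAlgebra ℝ A]

/-- Unique continuation for `C¹` solutions of `∑ⱼ cⱼ ∂ⱼ u = 0`, where `c' i * c j` is
Clifford-antisymmetric. -/
theorem eqOn_zero_of_dirac [Nonempty ι] [DecidableEq ι] {Ω : Set (EuclideanSpace ℝ ι)}
    (hΩ : IsOpen Ω) (hΩc : IsPreconnected Ω) {c c' : ι → A}
    (hc : ∀ i j, c' i * c j + c' j * c i = if i = j then 2 else 0)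
    {u : EuclideanSpace ℝ ι → A} (hu : ContDiffOn ℝ 1 u Ω)
    (hD : ∀ y ∈ Ω, ∑ j, c j * fderiv ℝ u y (EuclideanSpace.single j 1) = 0)
    {a : EuclideanSpace ℝ ι} (ha : a ∈ Ω) (hua : u =ᶠ[𝓝 a] 0) : EqOn u 0 Ω := by
  have hline : ∀ (ℓ : StrongDual ℝ A), ∀ b ∈ Ω, ∀ v : EuclideanSpace ℝ ι,
      AnalyticAt ℝ (fun t : ℝ => ℓ (u (b + t • v))) 0 := by
    intro ℓ b hb v
    let L : ι → ι → A →L[ℝ] ℝ := fun i j => ℓ ∘L ContinuousLinearMap.mul ℝ A (c' i * c j)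
    refine analyticAt_line_of_divergence_free (W := fun i j y => L i j (u y))
      (H := fun y => ℓ (u y)) hΩ (fun i j => (L i j).contDiff.comp_contDiffOn hu) ?_ ?_ hb v
    · intro i j y
      simp only [L, ContinuousLinearMap.comp_apply, ContinuousLinearMap.mul_apply', ← map_add,
        ← add_mul, hc]
      split_ifs
      · rw [two_mul, map_add, two_mul]
      · simp
    · intro i y hy
      have hdu : DifferentiableAt ℝ u y :=
        (hu.differentiableOn one_ne_zero).differentiableAt (hΩ.mem_nhds hy)
      have : ∀ j, fderiv ℝ (fun y => L i j (u y)) y (EuclideanSpace.single j 1)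
          = ℓ (c' i * (c j * fderiv ℝ u y (EuclideanSpace.single j 1))) := by
        intro j
        rw [fderiv_fun_comp y (L i j).differentiableAt hdu, (L i j).fderiv]
        simp [L, mul_assoc]
      simp only [this]
      rw [← map_sum, ← Finset.mul_sum, hD y hy, mul_zero, map_zero]
  let Z : Set (EuclideanSpace ℝ ι) := {x | u =ᶠ[𝓝 x] 0}
  have hZ : IsOpen Z := isOpen_setOfPred_eventually_nhds
  have hsub : Ω ⊆ Z := by
    refine hΩc.subset_of_closure_inter_subset hZ ⟨a, ha, hua⟩ ?_
    rintro x ⟨hxZ, hxΩ⟩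
    obtain ⟨r, hr, hrΩ⟩ := Metric.isOpen_iff.1 hΩ x hxΩ
    obtain ⟨b, hbZ, hb⟩ := Metric.mem_closure_iff.1 hxZ r hr
    have hbx : b ∈ ball x r := by rwa [mem_ball, dist_comm]
    filter_upwards [ball_mem_nhds x hr] with z hz
    have hseg : ∀ t ∈ Icc (0 : ℝ) 1, b + t • (z - b) ∈ ball x r := fun t ht =>
      (convex_ball x r).add_smul_sub_mem hbx hz ht
    refine SeparatingDual.eq_zero_of_forall_dual_eq_zero (R := ℝ) fun ℓ => ?_
    have han : AnalyticOnNhd ℝ (fun t : ℝ => ℓ (u (b + t • (z - b)))) (Icc 0 1) := by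
      intro t ht
      have h := hline ℓ _ (hrΩ (hseg t ht)) (z - b)
      have h' : AnalyticAt ℝ (fun s : ℝ => s - t) t := analyticAt_id.sub analyticAt_const
      have h'' := AnalyticAt.comp_of_eq h h' (sub_self t)
      refine h''.congr (.of_forall fun s => ?_)
      simp only [Function.comp]
      congr 2
      module
    have hev : (fun t : ℝ => ℓ (u (b + t • (z - b)))) =ᶠ[𝓝 0] 0 := by
      have hcont : ContinuousAt (fun t : ℝ => b + t • (z - b)) 0 := by fun_prop
      have hbZ' : ∀ᶠ y in 𝓝 (b + (0 : ℝ) • (z - b)), u y = 0 := by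
        rw [zero_smul, add_zero]
        exact hbZ
      filter_upwards [hcont.eventually hbZ'] with t ht
      simp [ht]
    have h1 := han.eqOn_zero_of_preconnected_of_eventuallyEq_zero isPreconnected_Icc
      (left_mem_Icc.2 zero_le_one) hev (right_mem_Icc.2 zero_le_one)
    simpa using h1
  exact fun x hx => (hsub hx).self_of_nhds

end CauchyKernel

section Clifford

variable {p q : ℕ} {A : Type*} [NormedRing A] [NormedAlgebra ℝ A] (ξ : A ≃ₐ[ℝ] Cl (p + q))

lemma gen_mul_gen_add_swap (i j : Fin (p + q)) :
    gen p q ξ i * gen p q ξ j + gen p q ξ j * gen p q ξ i = if i = j then -2 else 0 := by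
  have h : QuadraticMap.polar (Qe (p + q)) (Pi.single i 1) (Pi.single j 1)
      = if i = j then -2 else 0 := by
    simp only [QuadraticMap.polar, Qe, QuadraticMap.weightedSumSquares_apply, Pi.add_apply,
      smul_eq_mul, ← Finset.sum_sub_distrib]
    have : ∀ k, -1 * (((Pi.single i 1 : Fin (p + q) → ℝ) k + (Pi.single j 1 : _ → ℝ) k) *
        ((Pi.single i 1 : _ → ℝ) k + (Pi.single j 1 : _ → ℝ) k))
        - -1 * ((Pi.single i 1 : _ → ℝ) k * (Pi.single i 1 : _ → ℝ) k)
        - -1 * ((Pi.single j 1 : _ → ℝ) k * (Pi.single j 1 : _ → ℝ) k)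
        = if k = i then (if i = j then -2 else 0) else 0 := by
      intro k
      simp only [Pi.single_apply]
      split_ifs <;> simp_all
      norm_num
    simp only [this, Finset.sum_ite_eq', Finset.mem_univ, if_true]
  simp only [gen, e, ← map_mul, ← map_add, CliffordAlgebra.ι_mul_ι_add_swap, h]
  split_ifs
  · rw [map_neg, map_neg, AlgEquiv.commutes, map_ofNat]
  · simp

lemma eq_of_add_self_eq {a b : A} (h : a + a = b + b) : a = b := by
  have h2 : (2 : ℝ) • a = (2 : ℝ) • b := by rw [two_smul, two_smul, h]
  exact smul_right_injective A (two_ne_zero (α := ℝ)) h2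

lemma eQ_mul_eQ_add_swap (i j : Fin q) :
    eQ p q ξ i * eQ p q ξ j + eQ p q ξ j * eQ p q ξ i = if i = j then -2 else 0 := by
  simp only [eQ, gen_mul_gen_add_swap, Nat.add_left_cancel_iff, Fin.ext_iff]

lemma ωCl_mul_self {v : Vq q} (hv : v ∈ S q) : ωCl p q ξ v * ωCl p q ξ v = -1 := by
  have h1 : ωCl p q ξ v * ωCl p q ξ v
      = ∑ i, ∑ j, (v i * v j) • (eQ p q ξ i * eQ p q ξ j) := by
    simp only [ωCl, Finset.sum_mul_sum, smul_mul_smul_comm]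
  have h2 : ωCl p q ξ v * ωCl p q ξ v
      = ∑ i, ∑ j, (v i * v j) • (eQ p q ξ j * eQ p q ξ i) := by
    rw [h1, Finset.sum_comm]
    simp only [mul_comm]
  have hv' : ∑ j, v j ^ 2 = 1 := hv
  refine eq_of_add_self_eq ?_
  nth_rewrite 1 [h1]
  rw [h2]
  simp only [← Finset.sum_add_distrib, ← smul_add, eQ_mul_eQ_add_swap, smul_ite, smul_zero,
    Finset.sum_ite_eq, Finset.mem_univ, if_true, ← sq, ← Finset.sum_smul, hv', one_smul]
  norm_num

lemma εp_zero : εp p q ξ 0 = 1 := by simp [εp]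

lemma εp_mul_εp_add_swap {i j : Fin (p + 1)} (hi : i ≠ 0) (hj : j ≠ 0) :
    εp p q ξ i * εp p q ξ j + εp p q ξ j * εp p q ξ i = if i = j then -2 else 0 := by
  have hi' : (i : ℕ) ≠ 0 := fun h => hi (Fin.ext h)
  have hj' : (j : ℕ) ≠ 0 := fun h => hj (Fin.ext h)
  simp only [εp, hi', hj', dif_neg, not_false_eq_true, gen_mul_gen_add_swap, Fin.mk.injEq]
  congr 1
  rw [Fin.ext_iff, eq_iff_iff]
  omega

lemma εp_mul_ωCl {i : Fin (p + 1)} (hi : i ≠ 0) (v : Vq q) :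
    εp p q ξ i * ωCl p q ξ v = -(ωCl p q ξ v * εp p q ξ i) := by
  have hi' : (i : ℕ) ≠ 0 := fun h => hi (Fin.ext h)
  simp only [ωCl, Finset.mul_sum, Finset.sum_mul, ← Finset.sum_neg_distrib]
  refine Finset.sum_congr rfl fun j _ => ?_
  rw [mul_smul_comm, smul_mul_assoc, ← smul_neg]
  congr 1
  rw [eq_neg_iff_add_eq_zero]
  simp only [εp, eQ, hi', dif_neg, not_false_eq_true, gen_mul_gen_add_swap, Fin.mk.injEq]
  rw [if_neg]
  omega

lemma commute_εp_ωCl_mul_ωCl (i : Fin (p + 1)) (v w : Vq q) :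
    Commute (εp p q ξ i) (ωCl p q ξ v * ωCl p q ξ w) := by
  by_cases hi : i = 0
  · rw [hi, εp_zero]
    exact Commute.one_left _
  · rw [commute_iff_eq, ← mul_assoc, εp_mul_ωCl ξ hi, neg_mul, mul_assoc, εp_mul_ωCl ξ hi, mul_neg,
      neg_neg, mul_assoc]

lemma ωCl_neg (v : Vq q) : ωCl p q ξ (-v) = -ωCl p q ξ v := by
  simp [ωCl]

lemma neg_mem_S {v : Vq q} (hv : v ∈ S q) : -v ∈ S q := by
  simpa [S] using hv

/-- The slice directions, with the imaginary unit at `none`. -/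
def sliceCoeff (v : Vq q) : Option (Fin (p + 1)) → A
  | none => ωCl p q ξ v
  | some i => εp p q ξ i

/-- The Clifford conjugates of the slice directions. -/
def sliceCoeffConj (v : Vq q) : Option (Fin (p + 1)) → A
  | none => -ωCl p q ξ v
  | some i => if i = 0 then 1 else -εp p q ξ i

lemma sliceCoeffConj_mul_add_swap {v : Vq q} (hv : v ∈ S q) (i j : Option (Fin (p + 1))) :
    sliceCoeffConj ξ v i * sliceCoeff ξ v j + sliceCoeffConj ξ v j * sliceCoeff ξ v i
      = if i = j then 2 else 0 := by
  have hω := ωCl_mul_self ξ hv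
  have key : ∀ k, sliceCoeffConj ξ v none * sliceCoeff ξ v (some k)
      + sliceCoeffConj ξ v (some k) * sliceCoeff ξ v none = 0 := by
    intro k
    simp only [sliceCoeffConj, sliceCoeff]
    split_ifs with hk
    · simp [hk, εp_zero]
    · simp [εp_mul_ωCl ξ hk]
  rcases i with _ | i <;> rcases j with _ | j
  · simp [sliceCoeffConj, sliceCoeff, hω, one_add_one_eq_two]
  · simp [key j]
  · simp [add_comm, key i]
  · simp only [sliceCoeffConj, sliceCoeff, Option.some.injEq]
    by_cases hi : i = 0 <;> by_cases hj : j = 0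
    · simp [hi, hj, εp_zero, one_add_one_eq_two]
    · simp [hi, hj, εp_zero, Ne.symm hj]
    · simp [hi, hj, εp_zero]
    · have := εp_mul_εp_add_swap ξ hi hj
      simp only [if_neg hi, if_neg hj, neg_mul, ← neg_add, this]
      split_ifs <;> simp


/-- Euclidean coordinates on a slice, with the radial variable at `none`. -/
def sliceEquiv (p : ℕ) : EuclideanSpace ℝ (Option (Fin (p + 1))) ≃L[ℝ] Sl p :=
  LinearEquiv.toContinuousLinearEquiv
    { toFun := fun y => (fun i => y (some i), y none)
      invFun := fun z => WithLp.toLp 2 fun o => o.elim z.2 z.1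
      map_add' := fun _ _ => rfl
      map_smul' := fun _ _ => rfl
      left_inv := fun y => by ext (_ | i) <;> rfl
      right_inv := fun _ => rfl }

lemma sliceEquiv_single_some (i : Fin (p + 1)) :
    sliceEquiv p (EuclideanSpace.single (some i) 1) = (Pi.single i 1, 0) := by
  refine Prod.ext (funext fun j => ?_) ?_
  · change (EuclideanSpace.single (some i) (1 : ℝ)) (some j) = _
    simp [Pi.single_apply]
  · change (EuclideanSpace.single (some i) (1 : ℝ)) none = 0
    simp

lemma sliceEquiv_single_none :
    sliceEquiv p (EuclideanSpace.single none 1) = (0, 1) := by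
  refine Prod.ext (funext fun j => ?_) ?_
  · change (EuclideanSpace.single (none : Option (Fin (p + 1))) (1 : ℝ)) (some j) = 0
    simp
  · change (EuclideanSpace.single (none : Option (Fin (p + 1))) (1 : ℝ)) none = 1
    simp

/-- Solutions of the slice Dirac equation that vanish near a point vanish identically. -/
theorem eqOn_zero_of_eventuallyEq_zero {D : Set (Sl p)} (hD : IsOpen D) (hDc : IsPreconnected D)
    {v : Vq q} (hv : v ∈ S q) {g : Sl p → A} (hg : ContDiffOn ℝ 1 g D)
    (hdg : ∀ z ∈ D, DP p q ξ g z + ωCl p q ξ v * pdr p g z = 0)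
    {a : Sl p} (ha : a ∈ D) (hga : g =ᶠ[𝓝 a] 0) : EqOn g 0 D := by
  have key : EqOn (g ∘ sliceEquiv p) 0 (sliceEquiv p ⁻¹' D) := by
    refine eqOn_zero_of_dirac (hD.preimage (sliceEquiv p).continuous) ?_
      (sliceCoeffConj_mul_add_swap ξ hv)
      (hg.comp (sliceEquiv p).contDiff.contDiffOn fun _ h => h) ?_
      (a := (sliceEquiv p).symm a) (by simpa using ha) ?_
    · exact (sliceEquiv p).toHomeomorph.isPreconnected_preimage.2 hDc
    · intro y hy
      simp only [Fintype.sum_option, (sliceEquiv p).comp_right_fderiv,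
        ContinuousLinearMap.comp_apply, ContinuousLinearEquiv.coe_coe, sliceEquiv_single_some,
        sliceEquiv_single_none]
      rw [add_comm]
      exact hdg _ hy
    · have h : Tendsto (sliceEquiv p) (𝓝 ((sliceEquiv p).symm a)) (𝓝 a) := by
        simpa using (sliceEquiv p).continuous.tendsto ((sliceEquiv p).symm a)
      exact h.eventually hga
  intro z hz
  simpa using key (x := (sliceEquiv p).symm z) (by simpa using hz)

/-- A solution of the slice Dirac equation that vanishes on the axis has vanishing derivative
there. -/
lemma fderiv_eq_zero_of_axis {D : Set (Sl p)} (hD : IsOpen D) {v : Vq q} (hv : v ∈ S q)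
    {g : Sl p → A} (hg : ContDiffOn ℝ 1 g D)
    (hdg : ∀ z ∈ D, DP p q ξ g z + ωCl p q ξ v * pdr p g z = 0)
    (hg0 : ∀ z ∈ D, z.2 = 0 → g z = 0) {z : Sl p} (hz : z ∈ D) (hz0 : z.2 = 0) :
    fderiv ℝ g z = 0 := by
  have hdz : DifferentiableAt ℝ g z :=
    (hg.differentiableOn one_ne_zero).differentiableAt (hD.mem_nhds hz)
  have htan : ∀ w : Vp p, fderiv ℝ g z (w, 0) = 0 := by
    intro w
    have hl : HasDerivAt (fun t : ℝ => z + t • ((w, 0) : Sl p)) (w, 0) 0 := by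
      simpa using ((hasDerivAt_id (0 : ℝ)).smul_const ((w, 0) : Sl p)).const_add z
    have h1 : HasDerivAt (g ∘ fun t : ℝ => z + t • ((w, 0) : Sl p)) (fderiv ℝ g z (w, 0)) 0 := by
      refine HasFDerivAt.comp_hasDerivAt _ ?_ hl
      simpa using hdz.hasFDerivAt
    have h2 : (g ∘ fun t : ℝ => z + t • ((w, 0) : Sl p)) =ᶠ[𝓝 0] fun _ => 0 := by
      have : ∀ᶠ t : ℝ in 𝓝 0, z + t • ((w, 0) : Sl p) ∈ D :=
        hl.continuousAt.eventually_mem (by simpa using hD.mem_nhds hz)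
      filter_upwards [this] with t ht
      exact hg0 _ ht (by simp [hz0])
    exact h1.unique ((hasDerivAt_const 0 0).congr_of_eventuallyEq h2)
  have hrad : fderiv ℝ g z (0, 1) = 0 := by
    have h := hdg z hz
    have h0 : DP p q ξ g z = 0 := by simp [DP, pdSl, htan]
    rw [h0, zero_add] at h
    have h' := congrArg (ωCl p q ξ v * ·) h
    simpa [← mul_assoc, ωCl_mul_self ξ hv, pdr] using h'
  refine ContinuousLinearMap.ext fun y => ?_
  have hy : y = (y.1, 0) + y.2 • ((0, 1) : Sl p) := by ext <;> simp
  rw [hy, map_add, map_smul, htan, hrad]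
  simp

/-- Solutions of the slice Dirac equation that vanish on the axis vanish identically. -/
theorem eqOn_zero_of_axis {D : Set (Sl p)} (hD : IsOpen D) (hDc : IsPreconnected D)
    {v : Vq q} (hv : v ∈ S q) {g : Sl p → A} (hg : ContDiffOn ℝ 1 g D)
    (hdg : ∀ z ∈ D, DP p q ξ g z + ωCl p q ξ v * pdr p g z = 0)
    (hg0 : ∀ z ∈ D, z.2 = 0 → g z = 0) {x₀ : Vp p} (hx₀ : (x₀, 0) ∈ D) : EqOn g 0 D := by
  have hfd : ∀ z ∈ D, z.2 = 0 → fderiv ℝ g z = 0 := fun z hz hz0 =>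
    fderiv_eq_zero_of_axis ξ hD hv hg hdg hg0 hz hz0
  let g' : Sl p → A := fun z => if 0 < z.2 then g z else 0
  let dg' : Sl p → Sl p →L[ℝ] A := fun z => if 0 < z.2 then fderiv ℝ g z else 0
  have hd' : ∀ z ∈ D, HasFDerivAt g' (dg' z) z := by
    intro z hz
    have hdz : HasFDerivAt g (fderiv ℝ g z) z :=
      ((hg.differentiableOn one_ne_zero).differentiableAt (hD.mem_nhds hz)).hasFDerivAt
    rcases lt_trichotomy z.2 0 with h | h | h
    · have hev : g' =ᶠ[𝓝 z] fun _ => 0 := by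
        filter_upwards [continuousAt_snd.eventually_lt_const h] with y hy
        exact if_neg hy.not_gt
      simp only [dg', if_neg h.not_gt]
      exact (hasFDerivAt_const 0 z).congr_of_eventuallyEq hev
    · simp only [dg', h, lt_irrefl, if_false]
      rw [hfd z hz h] at hdz
      rw [hasFDerivAt_iff_isLittleO_nhds_zero] at hdz ⊢
      refine Asymptotics.IsBigO.trans_isLittleO (.of_bound' (.of_forall fun y => ?_)) hdz
      simp only [g', h, lt_irrefl, if_false, hg0 z hz h]
      split_ifs <;> simp
    · have hev : g' =ᶠ[𝓝 z] g := by
        filter_upwards [continuousAt_snd.eventually_const_lt h] with y hy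
        exact if_pos hy
      simp only [dg', if_pos h]
      exact hdz.congr_of_eventuallyEq hev
  have hg' : ContDiffOn ℝ 1 g' D := by
    rw [show (1 : WithTop ℕ∞) = 0 + 1 from rfl, contDiffOn_succ_iff_fderiv_of_isOpen hD]
    refine ⟨fun z hz => (hd' z hz).differentiableAt.differentiableWithinAt, by simp, ?_⟩
    rw [contDiffOn_zero]
    have hc : ContinuousOn (fderiv ℝ g) D := hg.continuousOn_fderiv_of_isOpen hD le_rfl
    have hc' : ContinuousOn dg' D := by
      refine ContinuousOn.if (fun z hz => ?_) (hc.mono inter_subset_left) continuousOn_const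
      exact hfd z hz.1 (frontier_lt_subset_eq continuous_const continuous_snd hz.2).symm
    exact hc'.congr fun z hz => (hd' z hz).fderiv
  have hdg' : ∀ z ∈ D, DP p q ξ g' z + ωCl p q ξ v * pdr p g' z = 0 := by
    intro z hz
    by_cases h : 0 < z.2
    · have h1 : fderiv ℝ g' z = fderiv ℝ g z := by rw [(hd' z hz).fderiv]; exact if_pos h
      simpa only [DP, pdSl, pdr, h1] using hdg z hz
    · have h1 : fderiv ℝ g' z = 0 := by rw [(hd' z hz).fderiv]; exact if_neg h
      simp [DP, pdSl, pdr, h1]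
  have hmem : ∀ᶠ t : ℝ in 𝓝 0, ((x₀, t) : Sl p) ∈ D :=
    (by fun_prop : ContinuousAt (fun t : ℝ => ((x₀, t) : Sl p)) 0).eventually_mem
      (hD.mem_nhds hx₀)
  obtain ⟨δ, hδ, hball⟩ := Metric.eventually_nhds_iff_ball.1 hmem
  have hneg : ((x₀, -(δ / 2)) : Sl p) ∈ D := hball _ (by simp [abs_of_pos hδ, hδ])
  have hpos : ((x₀, δ / 2) : Sl p) ∈ D := hball _ (by simp [abs_of_pos hδ, hδ])
  have hzero' : EqOn g' 0 D := by
    refine eqOn_zero_of_eventuallyEq_zero ξ hD hDc hv hg' hdg' hneg ?_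
    have : ((x₀, -(δ / 2)) : Sl p).2 < 0 := by simpa using hδ
    filter_upwards [continuousAt_snd.eventually_lt_const this] with y hy
    exact if_neg hy.not_gt
  refine eqOn_zero_of_eventuallyEq_zero ξ hD hDc hv hg hdg hpos ?_
  have : 0 < ((x₀, δ / 2) : Sl p).2 := by simpa using hδ
  filter_upwards [continuousAt_snd.eventually_const_lt this, hD.mem_nhds hpos] with y hy hyD
  rw [← hzero' hyD]
  exact (if_pos hy).symm

lemma dirac_const_mul {M o o' : A} (hM : ∀ i, Commute (εp p q ξ i) M) (ho : o * M = M * o')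
    {F : Sl p → A} {z : Sl p} (hF : DifferentiableAt ℝ F z) :
    DP p q ξ (fun y => M * F y) z + o * pdr p (fun y => M * F y) z
      = M * (DP p q ξ F z + o' * pdr p F z) := by
  have h : ∀ y, fderiv ℝ (fun y => M * F y) z y = M * fderiv ℝ F z y := fun y => by
    rw [show (fun y => M * F y) = fun y => ContinuousLinearMap.mul ℝ A M (F y) from rfl,
      fderiv_fun_comp z (ContinuousLinearMap.mul ℝ A M).differentiableAt hF,
      (ContinuousLinearMap.mul ℝ A M).fderiv]
    rfl
  simp only [DP, pdSl, pdr, h, mul_add, Finset.mul_sum, ← mul_assoc, ho, (hM _).eq]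

lemma dirac_sub {o : A} {F G : Sl p → A} {z : Sl p} (hF : DifferentiableAt ℝ F z)
    (hG : DifferentiableAt ℝ G z) :
    DP p q ξ (fun y => F y - G y) z + o * pdr p (fun y => F y - G y) z
      = DP p q ξ F z + o * pdr p F z - (DP p q ξ G z + o * pdr p G z) := by
  simp only [DP, pdSl, pdr, fderiv_fun_sub hF hG, sub_apply, mul_sub,
    Finset.sum_sub_distrib]
  abel

lemma neg_smul_mem_of_smul_mem {Ω : Set (V p q)} (hsym : IsPSymmetric p q Ω) {v w : Vq q} (hv : v ∈ S q)
    (hw : w ∈ S q) {x : Vp p} {r : ℝ} (h : ((x, r • v) : V p q) ∈ Ω) :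
    ((x, (-r) • w) : V p q) ∈ Ω := by
  rw [neg_smul, ← smul_neg]
  exact hsym x r v hv (-w) (neg_mem_S hw) h

theorem representation_formula_of_mem {Ω : Set (V p q)} (hΩ : IsSliceDomain p q Ω)
    (hsym : IsPSymmetric p q Ω) {f : V p q → A} (hf : GSMOn p q ξ Ω f) {x : Vp p} {r : ℝ}
    {v w : Vq q} (hv : v ∈ S q) (hw : w ∈ S q) (hx : ((x, r • v) : V p q) ∈ Ω) :
    f (x, r • v)
      = (2 : ℝ)⁻¹ • (f (x, r • w) + f (x, (-r) • w))
        + (2 : ℝ)⁻¹ • (ωCl p q ξ v * ωCl p q ξ w * (f (x, (-r) • w) - f (x, r • w))) := by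
  obtain ⟨x₀, hx₀⟩ := hΩ.2.1
  obtain ⟨hDo, hDc⟩ := hΩ.2.2 v hv
  set D := sliceSet p q Ω v
  have hD : ∀ u ∈ S q, sliceSet p q Ω u = D := fun u hu =>
    Set.ext fun z => ⟨hsym z.1 z.2 u hu v hv, hsym z.1 z.2 v hv u hu⟩
  have hcd : ∀ u ∈ S q, ContDiffOn ℝ 1 (fun z => f (spt p q u z)) D := fun u hu =>
    hD u hu ▸ (hf u hu).1
  have heq : ∀ u ∈ S q, ∀ z ∈ D, DP p q ξ (fun y => f (spt p q u y)) z
      + ωCl p q ξ u * pdr p (fun y => f (spt p q u y)) z = 0 := fun u hu =>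
    hD u hu ▸ (hf u hu).2
  have hdiff : ∀ u ∈ S q, ∀ z ∈ D, DifferentiableAt ℝ (fun z => f (spt p q u z)) z :=
    fun u hu z hz => ((hcd u hu).differentiableOn one_ne_zero).differentiableAt (hDo.mem_nhds hz)
  set ω := ωCl p q ξ v
  set η := ωCl p q ξ w
  have hω : ω * ω = -1 := ωCl_mul_self ξ hv
  have hη : η * η = -1 := ωCl_mul_self ξ hw
  let M : A := (2 : ℝ)⁻¹ • (1 - ω * η)
  let M' : A := (2 : ℝ)⁻¹ • (1 + ω * η)
  have hcomm : ∀ i, Commute (εp p q ξ i) (ω * η) := fun i => commute_εp_ωCl_mul_ωCl ξ i v w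
  have hM : ∀ i, Commute (εp p q ξ i) M := fun i =>
    ((Commute.one_right _).sub_right (hcomm i)).smul_right _
  have hM' : ∀ i, Commute (εp p q ξ i) M' := fun i =>
    ((Commute.one_right _).add_right (hcomm i)).smul_right _
  have hωM : ω * M = M * η := by
    simp only [M, mul_smul_comm, smul_mul_assoc, mul_sub, sub_mul, ← mul_assoc, hω]
    simp [mul_assoc, hη, add_comm]
  have hωM' : ω * M' = M' * ωCl p q ξ (-w) := by
    rw [ωCl_neg]
    change ω * M' = M' * -η
    simp only [M', mul_smul_comm, smul_mul_assoc, mul_add, add_mul, ← mul_assoc, hω]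
    simp [mul_assoc, hη, add_comm]
  let G : Sl p → A := fun z => M * f (spt p q w z)
  let G' : Sl p → A := fun z => M' * f (spt p q (-w) z)
  have hw' := neg_mem_S hw
  have hGc : ContDiffOn ℝ 1 G D := contDiffOn_const.mul (hcd w hw)
  have hGc' : ContDiffOn ℝ 1 G' D := contDiffOn_const.mul (hcd (-w) hw')
  have key : EqOn (fun z => f (spt p q v z) - G z - G' z) 0 D := by
    refine eqOn_zero_of_axis ξ hDo hDc.isPreconnected hv (((hcd v hv).sub hGc).sub hGc') ?_ ?_
      (x₀ := x₀) (by simpa [D, sliceSet, spt] using hx₀)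
    · intro z hz
      have hGd : DifferentiableAt ℝ G z := (hdiff w hw z hz).const_mul M
      have hGd' : DifferentiableAt ℝ G' z := (hdiff (-w) hw' z hz).const_mul M'
      rw [dirac_sub ξ ((hdiff v hv z hz).fun_sub hGd) hGd', dirac_sub ξ (hdiff v hv z hz) hGd,
        dirac_const_mul ξ hM hωM (hdiff w hw z hz),
        dirac_const_mul ξ hM' hωM' (hdiff (-w) hw' z hz), heq v hv z hz, heq w hw z hz,
        heq (-w) hw' z hz]
      simp
    · intro z _ hz0
      have hMM : M + M' = 1 := by
        simp only [M, M', ← smul_add, sub_add_add_cancel, ← two_smul ℝ (1 : A), smul_smul]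
        norm_num
      simp only [G, G', spt, hz0, zero_smul]
      rw [sub_sub, ← add_mul, hMM, one_mul, sub_self]
  have h := key (x := (x, r)) hx
  simp only [G, G', spt, smul_neg, ← neg_smul, Pi.zero_apply, sub_sub, sub_eq_zero] at h
  rw [h]
  simp only [M, M', smul_mul_assoc, sub_mul, add_mul, one_mul, mul_sub]
  module

end Clifford

end GPS

/-- **Representation Formula** (Theorem 2.6).  For a generalized partial-slice monogenic
function `f` on a p-symmetric slice domain `Ω`, for all `ω, η ∈ 𝕊` and `𝐱_p + rω ∈ Ω`,
`f(𝐱_p + rω) = ½(f(𝐱_p + rη) + f(𝐱_p − rη)) + ½ ωη (f(𝐱_p − rη) − f(𝐱_p + rη))`,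
and moreover `F₁ = ½(f(𝐱_p + rη) + f(𝐱_p − rη))` and
`F₂ = ½ η (f(𝐱_p − rη) − f(𝐱_p + rη))` do not depend on `η ∈ 𝕊`. -/
theorem representation_formula
    (p q : ℕ) (hq : 1 ≤ q) {A : Type*} [NormedRing A] [NormedAlgebra ℝ A]
    (ξ : A ≃ₐ[ℝ] Cl (p + q))
    (Ω : Set (V p q)) (hΩ : IsSliceDomain p q Ω) (hsym : IsPSymmetric p q Ω)
    (f : V p q → A) (hf : GSMOn p q ξ Ω f) :
    (∀ (x : Vp p) (r : ℝ), ∀ v ∈ S q, ∀ w ∈ S q, ((x, r • v) : V p q) ∈ Ω →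
      f (x, r • v)
        = (2 : ℝ)⁻¹ • (f (x, r • w) + f (x, (-r) • w))
          + (2 : ℝ)⁻¹ • (ωCl p q ξ v * ωCl p q ξ w * (f (x, (-r) • w) - f (x, r • w)))) ∧
    (∀ (x : Vp p) (r : ℝ), ∀ v ∈ S q, ∀ w ∈ S q, ((x, r • v) : V p q) ∈ Ω →
      (2 : ℝ)⁻¹ • (f (x, r • v) + f (x, (-r) • v))
        = (2 : ℝ)⁻¹ • (f (x, r • w) + f (x, (-r) • w)) ∧
      (2 : ℝ)⁻¹ • (ωCl p q ξ v * (f (x, (-r) • v) - f (x, r • v)))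
        = (2 : ℝ)⁻¹ • (ωCl p q ξ w * (f (x, (-r) • w) - f (x, r • w)))) := by
  have hrep : ∀ (x : Vp p) (r : ℝ), ∀ v ∈ S q, ∀ w ∈ S q, ((x, r • v) : V p q) ∈ Ω →
      f (x, r • v)
        = (2 : ℝ)⁻¹ • (f (x, r • w) + f (x, (-r) • w))
          + (2 : ℝ)⁻¹ • (ωCl p q ξ v * ωCl p q ξ w * (f (x, (-r) • w) - f (x, r • w))) :=
    fun x r v hv w hw hx => representation_formula_of_mem ξ hΩ hsym hf hv hw hx
  refine ⟨hrep, fun x r v hv w hw hx => ?_⟩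
  have h₁ := hrep x r v hv w hw hx
  have h₂ := hrep x (-r) v hv w hw (neg_smul_mem_of_smul_mem hsym hv hv hx)
  rw [neg_neg] at h₂
  constructor
  · rw [h₁, h₂]
    simp only [mul_sub]
    module
  · have hdiff : f (x, (-r) • v) - f (x, r • v)
        = -(ωCl p q ξ v * (ωCl p q ξ w * (f (x, (-r) • w) - f (x, r • w)))) := by
      rw [h₁, h₂]
      simp only [mul_sub, mul_assoc]
      module
    rw [hdiff, mul_neg, ← mul_assoc (ωCl p q ξ v), ωCl_mul_self ξ hv, neg_one_mul, neg_neg]
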